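/- arXiv:1211.0183 — 2 statements merged into one kernel-verified Lean document; each statement's English description precedes it below -/
import Mathlib

section
/- For density matrices ρ₁ and ρ₂ on a finite-dimensional Hilbert space with ρ₂ positive definite, the relative entropy S(ρ₁‖ρ₂) := tr[ρ₁ ln ρ₁] − tr[ρ₁ ln ρ₂] is nonnegative, with equality if and only if ρ₁ = ρ₂. -/
open Matrix BigOperators ComplexOrder

/-- Apply a real function to a Hermitian matrix via the spectral theorem
(junk value `0` for non-Hermitian input). -/
noncomputable def matFun {n : Type*} [Fintype n] [DecidableEq n]
    (f : ℝ → ℝ) (A : Matrix n n ℂ) : Matrix n n ℂ :=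
  if hA : A.IsHermitian then
    (hA.eigenvectorUnitary : Matrix n n ℂ) *
      Matrix.diagonal (fun i => (f (hA.eigenvalues i) : ℂ)) *
      star (hA.eigenvectorUnitary : Matrix n n ℂ)
  else 0

/-- Matrix logarithm of a Hermitian matrix. -/
noncomputable def matLog {n : Type*} [Fintype n] [DecidableEq n]
    (A : Matrix n n ℂ) : Matrix n n ℂ := matFun Real.log A

/-- Matrix exponential of a Hermitian matrix. -/
noncomputable def matExp {n : Type*} [Fintype n] [DecidableEq n]
    (A : Matrix n n ℂ) : Matrix n n ℂ := matFun Real.exp A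

/-- The Gibbs state `e^{-βH}/tr[e^{-βH}]`. -/
noncomputable def gibbs {n : Type*} [Fintype n] [DecidableEq n]
    (β : ℝ) (H : Matrix n n ℂ) : Matrix n n ℂ :=
  (matExp ((-β) • H)).trace⁻¹ • matExp ((-β) • H)

/-- A density matrix: positive semidefinite with unit trace. -/
def IsDensity {n : Type*} [Fintype n] [DecidableEq n] (ρ : Matrix n n ℂ) : Prop :=
  ρ.PosSemidef ∧ ρ.trace = 1

/-- von Neumann entropy `S(ρ) = -tr[ρ ln ρ]`. -/
noncomputable def vnEntropy {n : Type*} [Fintype n] [DecidableEq n]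
    (ρ : Matrix n n ℂ) : ℝ := -((ρ * matLog ρ).trace.re)

/-- Relative entropy `S(ρ‖σ) = tr[ρ ln ρ] - tr[ρ ln σ]`. -/
noncomputable def relEnt {n : Type*} [Fintype n] [DecidableEq n]
    (ρ σ : Matrix n n ℂ) : ℝ :=
  ((ρ * matLog ρ).trace - (ρ * matLog σ).trace).re


lemma klein_trace {n : Type*} [Fintype n] [DecidableEq n]
    (U W : Matrix n n ℂ) (f g : n → ℝ) :
    ((U * diagonal (fun i => (f i : ℂ)) * star U) *
      (W * diagonal (fun i => (g i : ℂ)) * star W)).trace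
      = ((∑ i, ∑ j, Complex.normSq ((star U * W) i j) * (f i * g j) : ℝ) : ℂ) := by
  have h1 : ((U * diagonal (fun i => (f i : ℂ)) * star U) *
      (W * diagonal (fun i => (g i : ℂ)) * star W)).trace
      = ((diagonal (fun i => (f i : ℂ)) * (star U * W)) *
          (diagonal (fun i => (g i : ℂ)) * star (star U * W))).trace := by
    rw [star_mul, star_star, Matrix.mul_assoc, Matrix.mul_assoc, Matrix.trace_mul_comm]
    simp only [Matrix.mul_assoc]
  rw [h1]
  simp only [Matrix.trace, Matrix.diag_apply]
  push_cast
  refine Finset.sum_congr rfl fun i _ => ?_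
  rw [Matrix.mul_apply]
  refine Finset.sum_congr rfl fun j _ => ?_
  rw [Matrix.diagonal_mul, Matrix.diagonal_mul, Matrix.star_apply, Complex.normSq_eq_conj_mul_self]
  simp only [RCLike.star_def]
  ring

lemma klein_scalar {p q : ℝ} (hp : 0 ≤ p) (hq : 0 < q) :
    0 ≤ p * Real.log p - p * Real.log q - p + q ∧
    (p * Real.log p - p * Real.log q - p + q = 0 → p = q) := by
  rcases hp.eq_or_lt with rfl | hp
  · simp [hq.le]
    intro h; exact h.symm
  · have hx : 0 < q / p := div_pos hq hp
    have e : p * Real.log p - p * Real.log q - p + q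
        = p * (q / p - 1 - Real.log (q / p)) := by
      rw [Real.log_div hq.ne' hp.ne']
      field_simp
      ring
    rw [e]
    constructor
    · have := Real.log_le_sub_one_of_pos hx
      exact mul_nonneg hp.le (by linarith)
    · intro h
      by_contra hne
      have hne' : q / p ≠ 1 := by
        intro h'
        rw [div_eq_one_iff_eq hp.ne'] at h'
        exact hne h'.symm
      have := Real.log_lt_sub_one_of_pos hx hne'
      have : 0 < p * (q / p - 1 - Real.log (q / p)) := mul_pos hp (by linarith)
      linarith

lemma klein_spec {n : Type*} [Fintype n] [DecidableEq n] {A : Matrix n n ℂ}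
    (hA : A.IsHermitian) :
    A = (hA.eigenvectorUnitary : Matrix n n ℂ) *
      Matrix.diagonal (fun i => (hA.eigenvalues i : ℂ)) *
      star (hA.eigenvectorUnitary : Matrix n n ℂ) := by
  conv_lhs => rw [hA.spectral_theorem]
  rfl

/-- nonnegativity of relative entropy, with equality iff the states agree. -/
theorem relEnt_nonneg_and_eq_zero_iff {n : Type*} [Fintype n] [DecidableEq n]
    (ρ₁ ρ₂ : Matrix n n ℂ) (h₁ : IsDensity ρ₁) (h₂ : IsDensity ρ₂) (h₂pd : ρ₂.PosDef) :
    0 ≤ relEnt ρ₁ ρ₂ ∧ (relEnt ρ₁ ρ₂ = 0 ↔ ρ₁ = ρ₂) := by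
  obtain ⟨hpsd, ht1⟩ := h₁
  obtain ⟨-, ht2⟩ := h₂
  have hA := hpsd.isHermitian
  have hB := h₂pd.isHermitian
  have hp : ∀ i, 0 ≤ hA.eigenvalues i := fun i => hpsd.eigenvalues_nonneg i
  have hq : ∀ i, 0 < hB.eigenvalues i := fun i => h₂pd.eigenvalues_pos i
  have s1 := klein_spec hA
  have s2 := klein_spec hB
  have l1 : matLog ρ₁ = _ := dif_pos hA
  have l2 : matLog ρ₂ = _ := dif_pos hB
  have uU : star (hA.eigenvectorUnitary : Matrix n n ℂ) * hA.eigenvectorUnitary = 1 :=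
    Unitary.coe_star_mul_self _
  have uU' : (hA.eigenvectorUnitary : Matrix n n ℂ) * star (hA.eigenvectorUnitary : Matrix n n ℂ) = 1 :=
    Unitary.coe_mul_star_self _
  have uW' : (hB.eigenvectorUnitary : Matrix n n ℂ) * star (hB.eigenvectorUnitary : Matrix n n ℂ) = 1 :=
    Unitary.coe_mul_star_self _
  generalize (hA.eigenvectorUnitary : Matrix n n ℂ) = U at *
  generalize (hB.eigenvectorUnitary : Matrix n n ℂ) = W at *
  generalize hA.eigenvalues = p at *
  generalize hB.eigenvalues = q at *
  have d1 : diagonal (fun _ : n => ((1 : ℝ) : ℂ)) = 1 := by simp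
  have k1 := klein_trace U W (fun i => p i * Real.log (p i)) (fun _ => 1)
  have k2 := klein_trace U W p (fun i => Real.log (q i))
  have k3 := klein_trace U W p (fun _ => 1)
  have k4 := klein_trace U W (fun _ => 1) q
  rw [d1, Matrix.mul_one, uW', Matrix.mul_one] at k1 k3
  rw [d1, Matrix.mul_one, uU', Matrix.one_mul, ← s2, ht2] at k4
  rw [← s1, ht1] at k3
  rw [← s1, ← l2] at k2
  have m1 : ρ₁ * matLog ρ₁
      = U * diagonal (fun i => ((p i * Real.log (p i) : ℝ) : ℂ)) * star U := by
    rw [l1]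
    conv_lhs => rw [s1]
    calc _ = U * (diagonal (fun i => (p i : ℂ)) * (star U * U) *
              diagonal (fun i => (Real.log (p i) : ℂ))) * star U := by
            simp only [Matrix.mul_assoc]
      _ = _ := by
            rw [uU, Matrix.mul_one, Matrix.diagonal_mul_diagonal]
            simp
  rw [← m1] at k1
  have k3' := Complex.ofReal_injective ((Complex.ofReal_one).trans k3)
  have k4' := Complex.ofReal_injective ((Complex.ofReal_one).trans k4)
  have key : relEnt ρ₁ ρ₂ = ∑ i, ∑ j, Complex.normSq ((star U * W) i j) *
      (p i * Real.log (p i) - p i * Real.log (q j) - p i + q j) := by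
    have : relEnt ρ₁ ρ₂ = (∑ i, ∑ j, Complex.normSq ((star U * W) i j) *
        (p i * Real.log (p i) * 1)) - (∑ i, ∑ j, Complex.normSq ((star U * W) i j) *
        (p i * Real.log (q j))) - (∑ i, ∑ j, Complex.normSq ((star U * W) i j) *
        (p i * 1)) + ∑ i, ∑ j, Complex.normSq ((star U * W) i j) * (1 * q j) := by
      rw [← k3', ← k4']
      unfold relEnt
      rw [k1, k2, ← Complex.ofReal_sub, Complex.ofReal_re]
      ring
    rw [this]
    simp only [← Finset.sum_sub_distrib, ← Finset.sum_add_distrib]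
    refine Finset.sum_congr rfl fun i _ => Finset.sum_congr rfl fun j _ => ?_
    ring
  have hnn : ∀ i j, 0 ≤ Complex.normSq ((star U * W) i j) *
      (p i * Real.log (p i) - p i * Real.log (q j) - p i + q j) := fun i j =>
    mul_nonneg (Complex.normSq_nonneg _) (klein_scalar (hp i) (hq j)).1
  refine ⟨?_, ?_, ?_⟩
  · rw [key]
    exact Finset.sum_nonneg fun i _ => Finset.sum_nonneg fun j _ => hnn i j
  · intro h0
    rw [key, Finset.sum_eq_zero_iff_of_nonneg
      (fun i _ => Finset.sum_nonneg fun j _ => hnn i j)] at h0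
    have h1 : ∀ i j, (star U * W) i j = 0 ∨ p i = q j := by
      intro i j
      have := h0 i (Finset.mem_univ _)
      rw [Finset.sum_eq_zero_iff_of_nonneg (fun j _ => hnn i j)] at this
      rcases mul_eq_zero.1 (this j (Finset.mem_univ _)) with h | h
      · exact Or.inl (Complex.normSq_eq_zero.1 h)
      · exact Or.inr ((klein_scalar (hp i) (hq j)).2 h)
    have h2 : diagonal (fun i => (p i : ℂ)) * (star U * W)
        = (star U * W) * diagonal (fun i => (q i : ℂ)) := by
      ext i j
      rw [Matrix.diagonal_mul, Matrix.mul_diagonal]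
      rcases h1 i j with h | h
      · simp [h]
      · rw [h, mul_comm]
    calc ρ₁ = U * (diagonal (fun i => (p i : ℂ)) * (star U * W)) * star W := by
          conv_lhs => rw [s1]
          simp only [Matrix.mul_assoc, uW', Matrix.mul_one]
      _ = (U * star U) * (W * diagonal (fun i => (q i : ℂ)) * star W) := by
          rw [h2]; simp only [Matrix.mul_assoc]
      _ = ρ₂ := by rw [uU', Matrix.one_mul, ← s2]
  · rintro rfl
    simp [relEnt]
end

section
/- For Gibbs configurations (ρ_i, H_i) at β_i and (ρ_f, H_f) at β_f on an N-dimensional Hilbert space, the maximum over unitaries V of the heat tr[(ρ_f − V ρ_i V†) H_f] equals Σ_k H_f(k)·(e^{−β_f H_f(k)}/Z_f − e^{−β_i H_i(k)}/Z_i), where H_f(k) and H_i(k) are the eigenvalues of H_f and H_i in decreasing order and Z_i, Z_f are the partition functions. -/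
open Matrix BigOperators ComplexOrder

lemma matFun_eq_cfc {N : ℕ} (f : ℝ → ℝ) (A : Matrix (Fin N) (Fin N) ℂ) (hA : A.IsHermitian) :
    matFun f A = cfc f A := by
  rw [hA.cfc_eq f, Matrix.IsHermitian.cfc, matFun, dif_pos hA, Unitary.conjStarAlgAut_apply]
  rfl

lemma exists_unitary_cfc {N : ℕ} (A : Matrix (Fin N) (Fin N) ℂ) (hA : A.IsHermitian)
    (α : Fin N → ℝ) (h : ∃ e : Equiv.Perm (Fin N), ∀ k, α k = hA.eigenvalues (e k)) :
    ∃ U ∈ Matrix.unitaryGroup (Fin N) ℂ, ∀ f : ℝ → ℝ,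
      cfc f A = U * Matrix.diagonal (fun k => (f (α k) : ℂ)) * star U := by
  obtain ⟨e, he⟩ := h
  have hU := hA.eigenvectorUnitary.2
  set U : Matrix (Fin N) (Fin N) ℂ := (hA.eigenvectorUnitary).1 with hUdef
  refine ⟨U.submatrix id e, ?_, ?_⟩
  · rw [Matrix.mem_unitaryGroup_iff] at hU ⊢
    rw [Matrix.star_eq_conjTranspose, Matrix.conjTranspose_submatrix,
      Matrix.submatrix_mul_equiv, ← Matrix.star_eq_conjTranspose, hU]
    simp
  · intro f
    rw [← matFun_eq_cfc f A hA, matFun, dif_pos hA, ← hUdef]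
    have : Matrix.diagonal (fun k => (f (α k) : ℂ)) =
        (Matrix.diagonal (fun k => (f (hA.eigenvalues k) : ℂ))).submatrix e e := by
      rw [Matrix.submatrix_diagonal_equiv]
      congr 1
      funext k
      simp [he]
    rw [this, Matrix.star_eq_conjTranspose, Matrix.star_eq_conjTranspose,
      Matrix.conjTranspose_submatrix,
      Matrix.submatrix_mul_equiv, Matrix.submatrix_mul_equiv]
    simp

lemma gibbs_eq {N : ℕ} (A : Matrix (Fin N) (Fin N) ℂ) (hA : A.IsHermitian)
    (α : Fin N → ℝ) (β Z : ℝ) (hZ : Z = ∑ k, Real.exp (-β * α k))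
    (U : Matrix (Fin N) (Fin N) ℂ) (hU : U ∈ Matrix.unitaryGroup (Fin N) ℂ)
    (h : ∀ f : ℝ → ℝ, cfc f A = U * Matrix.diagonal (fun k => (f (α k) : ℂ)) * star U) :
    gibbs β A = U * Matrix.diagonal (fun k => ((Real.exp (-β * α k) / Z : ℝ) : ℂ)) * star U := by
  have hA' : IsSelfAdjoint A := hA
  have hB : ((-β) • A).IsHermitian := by
    have : IsSelfAdjoint ((-β) • A) := (IsSelfAdjoint.all (-β)).smul hA
    exact this
  have hE : matExp ((-β) • A) =
      U * Matrix.diagonal (fun k => ((Real.exp (-β * α k) : ℝ) : ℂ)) * star U := by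
    rw [matExp, matFun_eq_cfc _ _ hB,
      ← cfc_comp_const_mul (-β) Real.exp A (by fun_prop) hA', h]
  have hT : (matExp ((-β) • A)).trace = (Z : ℂ) := by
    rw [hE, Matrix.trace_mul_cycle, Matrix.mem_unitaryGroup_iff'.1 hU, one_mul,
      Matrix.trace_diagonal, hZ]
    push_cast
    rfl
  rw [gibbs, hT, hE, ← Matrix.smul_mul, ← Matrix.mul_smul, ← Matrix.diagonal_smul]
  congr 3
  funext k
  simp [div_eq_inv_mul]

lemma trace_formula {N : ℕ} (W : Matrix (Fin N) (Fin N) ℂ) (p q : Fin N → ℝ) :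
    (W * Matrix.diagonal (fun k => (p k : ℂ)) * star W *
      Matrix.diagonal (fun k => (q k : ℂ))).trace.re =
      ∑ j, ∑ k, Complex.normSq (W j k) * (q j * p k) := by
  simp only [Matrix.trace, Matrix.diag_apply, Matrix.mul_diagonal, Complex.re_sum]
  refine Finset.sum_congr rfl fun j _ => ?_
  rw [Matrix.mul_apply, Finset.sum_mul, Complex.re_sum]
  refine Finset.sum_congr rfl fun k _ => ?_
  rw [Matrix.mul_diagonal, Matrix.star_apply]
  simp [Complex.normSq_apply]
  ring

lemma normSq_doublyStochastic {N : ℕ} (W : Matrix (Fin N) (Fin N) ℂ)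
    (hW : W ∈ Matrix.unitaryGroup (Fin N) ℂ) :
    (Matrix.of fun j k => Complex.normSq (W j k)) ∈ doublyStochastic ℝ (Fin N) := by
  rw [mem_doublyStochastic_iff_sum]
  refine ⟨fun i j => Complex.normSq_nonneg _, fun i => ?_, fun j => ?_⟩
  · have h := congrFun (congrFun (Matrix.mem_unitaryGroup_iff.1 hW) i) i
    rw [Matrix.mul_apply, Matrix.one_apply_eq] at h
    have h' := congrArg Complex.re h
    rw [Complex.re_sum, Complex.one_re] at h'
    rw [← h']
    refine Finset.sum_congr rfl fun k _ => ?_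
    simp [Complex.normSq_apply, Matrix.star_apply]
  · have h := congrFun (congrFun (Matrix.mem_unitaryGroup_iff'.1 hW) j) j
    rw [Matrix.mul_apply, Matrix.one_apply_eq] at h
    have h' := congrArg Complex.re h
    rw [Complex.re_sum, Complex.one_re] at h'
    rw [← h']
    refine Finset.sum_congr rfl fun k _ => ?_
    simp [Complex.normSq_apply, Matrix.star_apply]

lemma rearr {N : ℕ} (D : Matrix (Fin N) (Fin N) ℝ) (hD : D ∈ doublyStochastic ℝ (Fin N))
    (p q : Fin N → ℝ) (hpq : Antivary q p) :
    ∑ k, q k * p k ≤ ∑ j, ∑ k, D j k * (q j * p k) := by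
  obtain ⟨w, hw0, hw1, rfl⟩ := exists_eq_sum_perm_of_mem_doublyStochastic hD
  have key : ∑ j, ∑ k, (∑ σ, w σ • σ.permMatrix ℝ : Matrix (Fin N) (Fin N) ℝ) j k * (q j * p k)
      = ∑ σ : Equiv.Perm (Fin N), w σ * ∑ j, q j * p (σ j) := by
    simp only [Matrix.sum_apply, Matrix.smul_apply, Finset.sum_mul, Finset.mul_sum, smul_eq_mul]
    rw [Finset.sum_congr rfl fun j _ => Finset.sum_comm, Finset.sum_comm]
    refine Finset.sum_congr rfl fun σ _ => Finset.sum_congr rfl fun j _ => ?_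
    rw [Finset.sum_eq_single (σ j)]
    · simp [PEquiv.toMatrix_apply]
    · intro k _ hk
      simp [PEquiv.toMatrix_apply, Ne.symm hk]
    · simp
  rw [key, ← one_mul (∑ k, q k * p k), ← hw1, Finset.sum_mul]
  exact Finset.sum_le_sum fun σ _ =>
    mul_le_mul_of_nonneg_left (hpq.sum_mul_le_sum_mul_comp_perm) (hw0 σ)

/-- maximum heat of a DUT+DTT process between Gibbs configurations. -/
theorem max_heat_DUT_DTT {N : ℕ}
    (Hi Hf : Matrix (Fin N) (Fin N) ℂ) (hHi : Hi.IsHermitian) (hHf : Hf.IsHermitian)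
    (βi βf : ℝ) (hβi : 0 < βi) (hβf : 0 < βf)
    (αi αf : Fin N → ℝ) (hαi : Antitone αi) (hαf : Antitone αf)
    (hαie : ∃ e : Equiv.Perm (Fin N), ∀ k, αi k = hHi.eigenvalues (e k))
    (hαfe : ∃ e : Equiv.Perm (Fin N), ∀ k, αf k = hHf.eigenvalues (e k))
    (Zi Zf : ℝ) (hZi : Zi = ∑ k, Real.exp (-βi * αi k))
    (hZf : Zf = ∑ k, Real.exp (-βf * αf k))
    (ρi ρf : Matrix (Fin N) (Fin N) ℂ)
    (hρi : ρi = gibbs βi Hi) (hρf : ρf = gibbs βf Hf) :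
    IsGreatest {x : ℝ | ∃ V ∈ Matrix.unitaryGroup (Fin N) ℂ,
        x = ((ρf - V * ρi * star V) * Hf).trace.re}
      (∑ k, αf k * (Real.exp (-βf * αf k) / Zf - Real.exp (-βi * αi k) / Zi)) := by
  obtain ⟨Ui, hUi, hci⟩ := exists_unitary_cfc Hi hHi αi hαie
  obtain ⟨Uf, hUf, hcf⟩ := exists_unitary_cfc Hf hHf αf hαfe
  have hgi := gibbs_eq Hi hHi αi βi Zi hZi Ui hUi hci
  have hgf := gibbs_eq Hf hHf αf βf Zf hZf Uf hUf hcf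
  have hHfe : Hf = Uf * Matrix.diagonal (fun k => (αf k : ℂ)) * star Uf := by
    have hHf' : IsSelfAdjoint Hf := hHf
    have := hcf id
    rwa [cfc_id ℝ Hf hHf'] at this
  have hZi0 : 0 ≤ Zi := by
    rw [hZi]
    exact Finset.sum_nonneg fun k _ => (Real.exp_pos _).le
  set p : Fin N → ℝ := fun k => Real.exp (-βi * αi k) / Zi with hp
  set r : Fin N → ℝ := fun k => Real.exp (-βf * αf k) / Zf with hr
  have hpm : Monotone p := by
    intro a b hab
    have := hαi hab
    simp only [hp]
    gcongr ?_ / _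
    apply Real.exp_le_exp.2
    nlinarith
  have hanti : Antivary αf p := hαf.antivary hpm
  have gen : ∀ (V U : Matrix (Fin N) (Fin N) ℂ) (s : Fin N → ℝ),
      ((V * (U * Matrix.diagonal (fun k => (s k : ℂ)) * star U) * star V) * Hf).trace.re =
      ∑ j, ∑ k, Complex.normSq ((star Uf * V * U) j k) * (αf j * s k) := by
    intro V U s
    rw [← trace_formula, hHfe]
    congr 1
    rw [← mul_assoc, Matrix.trace_mul_comm]
    simp only [star_mul, star_star, mul_assoc]
  have hone : ∀ s : Fin N → ℝ,
      ∑ j, ∑ k, Complex.normSq ((1 : Matrix (Fin N) (Fin N) ℂ) j k) * (αf j * s k)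
        = ∑ k, αf k * s k := by
    intro s
    refine Finset.sum_congr rfl fun j _ => ?_
    rw [Finset.sum_eq_single j]
    · simp
    · intro k _ hk
      simp [Matrix.one_apply_ne (Ne.symm hk)]
    · simp
  have hUfU := Matrix.mem_unitaryGroup_iff'.1 hUf
  have hUiU := Matrix.mem_unitaryGroup_iff'.1 hUi
  have hf : (ρf * Hf).trace.re = ∑ k, αf k * r k := by
    have := gen 1 Uf r
    rw [mul_one, hUfU, hone, star_one, one_mul, mul_one] at this
    rw [← this, hρf, hgf]
  have hsplit : ∀ V : Matrix (Fin N) (Fin N) ℂ,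
      ((ρf - V * ρi * star V) * Hf).trace.re = ∑ k, αf k * r k -
        ∑ j, ∑ k, Complex.normSq ((star Uf * V * Ui) j k) * (αf j * p k) := by
    intro V
    rw [sub_mul, Matrix.trace_sub, Complex.sub_re, hf, hρi, hgi, gen]
  have hgoal : ∑ k, αf k * (Real.exp (-βf * αf k) / Zf - Real.exp (-βi * αi k) / Zi) =
      ∑ k, αf k * r k - ∑ k, αf k * p k := by
    rw [← Finset.sum_sub_distrib]
    exact Finset.sum_congr rfl fun k _ => mul_sub _ _ _
  rw [hgoal]
  constructor
  · refine ⟨Uf * star Ui, mul_mem hUf (Unitary.star_mem hUi), ?_⟩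
    rw [hsplit]
    have : star Uf * (Uf * star Ui) * Ui = 1 := by
      rw [← mul_assoc, hUfU, one_mul, hUiU]
    rw [this, hone]
  · rintro x ⟨V, hV, rfl⟩
    rw [hsplit]
    have hW : star Uf * V * Ui ∈ Matrix.unitaryGroup (Fin N) ℂ :=
      mul_mem (mul_mem (Unitary.star_mem hUf) hV) hUi
    have := rearr _ (normSq_doublyStochastic _ hW) p αf hanti
    simp only [Matrix.of_apply] at this
    linarith
end
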